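/- Let a < b be reals and let p : [a,b] → [1,∞) be Lebesgue integrable and essentially bounded (esssup_{[a,b]} p < ∞). Let (f_n) be a sequence of functions in WBV_{p(·)}[a,b] and let K, M > 0 be such that |f_n(x)| ≤ K for all n and all x ∈ [a,b], and V_a^b(p, f_n) ≤ M for all n. Then there exist a strictly increasing sequence of indices (n_k) and a function f ∈ WBV_{p(·)}[a,b] with V_a^b(p,f) ≤ M such that f_{n_k}(x) → f(x) as k → ∞ for every x ∈ [a,b]. -/

import Mathlib

open MeasureTheory Set Filter
open scoped ENNReal

/-- The harmonic mean exponent `p̄([u,v]) = ((v-u)⁻¹ ∫_u^v 1/p)⁻¹`. -/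
noncomputable def pbar (p : ℝ → ℝ) (u v : ℝ) : ℝ :=
  ((v - u)⁻¹ * ∫ t in u..v, (p t)⁻¹)⁻¹

/-- `t 0 = c < t 1 < ⋯ < t n = d` is a partition of `[c,d]`. -/
def IsPartition (c d : ℝ) (n : ℕ) (t : ℕ → ℝ) : Prop :=
  0 < n ∧ t 0 = c ∧ t n = d ∧ ∀ k < n, t k < t (k + 1)

/-- The Wiener variable-exponent variation `V_c^d(p, f)`, valued in `[0,∞]`. -/
noncomputable def wienerVar (p f : ℝ → ℝ) (c d : ℝ) : ℝ≥0∞ :=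
  ⨆ (n : ℕ) (t : ℕ → ℝ) (_ : IsPartition c d n t),
    ENNReal.ofReal (∑ k ∈ Finset.range n,
      |f (t (k + 1)) - f (t k)| ^ pbar p (t k) (t (k + 1)))

/-- The Luxemburg norm `inf {λ > 0 : V_a^b(p, f/λ) ≤ 1}`, valued in `[0,∞]`. -/
noncomputable def luxNorm (p f : ℝ → ℝ) (a b : ℝ) : ℝ≥0∞ :=
  ⨅ (l : ℝ) (_ : 0 < l) (_ : wienerVar p (fun x => f x / l) a b ≤ 1),
    ENNReal.ofReal l

/-- Membership in the space `WBV_{p(·)}[a,b]`. -/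
def MemWBV (p f : ℝ → ℝ) (a b : ℝ) : Prop :=
  f a = 0 ∧ luxNorm p f a b < ⊤


/-- An essentially bounded exponent `p ≥ 1` has all its harmonic means between `1` and its bound. -/
lemma pbar_mem_Icc {a b P : ℝ} {p : ℝ → ℝ} (hp1 : ∀ x ∈ Set.Icc a b, 1 ≤ p x)
    (hpint : IntegrableOn p (Set.Icc a b))
    (hP1 : 1 ≤ P) (hP : ∀ᵐ x ∂(volume.restrict (Set.Icc a b)), p x ≤ P)
    {u v : ℝ} (hau : a ≤ u) (huv : u < v) (hvb : v ≤ b) :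
    pbar p u v ∈ Set.Icc 1 P := by
  have hsub : Set.Icc u v ⊆ Set.Icc a b := Set.Icc_subset_Icc hau hvb
  have hone : ∀ x ∈ Set.Icc u v, (p x)⁻¹ ≤ 1 := fun x hx => inv_le_one_of_one_le₀ (hp1 x (hsub hx))
  have hinv : IntegrableOn (fun t => (p t)⁻¹) (Set.Icc u v) := by
    refine Integrable.of_bound
      (hpint.mono_set hsub).aemeasurable.inv.aestronglyMeasurable 1 ?_
    filter_upwards [ae_restrict_mem measurableSet_Icc] with x hx
    have := hp1 x (hsub hx)
    rw [Real.norm_of_nonneg (by positivity)]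
    exact hone x hx
  have hint : IntervalIntegrable (fun t => (p t)⁻¹) volume u v :=
    (intervalIntegrable_iff_integrableOn_Icc_of_le huv.le).2 hinv
  have hupper : ∫ t in u..v, (p t)⁻¹ ≤ v - u := by
    have h := intervalIntegral.integral_mono_on huv.le hint
      (intervalIntegrable_const (c := (1 : ℝ))) hone
    simpa using h
  have hlower : (v - u) * P⁻¹ ≤ ∫ t in u..v, (p t)⁻¹ := by
    have h := intervalIntegral.integral_mono_ae_restrict huv.le
      (intervalIntegrable_const (c := P⁻¹)) hint (by
        filter_upwards [ae_restrict_mem measurableSet_Icc, ae_restrict_of_ae_restrict_of_subset hsub hP]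
          with x hx hx'
        have := hp1 x (hsub hx)
        exact inv_anti₀ (by linarith) hx')
    simpa using h
  have hd : 0 < v - u := sub_pos.2 huv
  have hPpos : 0 < P := by linarith
  have h1 : (v - u)⁻¹ * (∫ t in u..v, (p t)⁻¹) ≤ 1 := by
    rw [inv_mul_le_iff₀ hd]; simpa using hupper
  have h2 : P⁻¹ ≤ (v - u)⁻¹ * ∫ t in u..v, (p t)⁻¹ := by
    rw [le_inv_mul_iff₀ hd]; exact hlower
  have hpos : 0 < P⁻¹ := inv_pos.2 hPpos
  exact ⟨(one_le_inv₀ (hpos.trans_le h2)).2 h1, inv_le_of_inv_le₀ hPpos h2⟩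

lemma IsPartition.apply_le_apply {c d : ℝ} {n : ℕ} {t : ℕ → ℝ} (ht : IsPartition c d n t)
    {i j : ℕ} (hij : i ≤ j) (hj : j ≤ n) : t i ≤ t j := by
  induction j, hij using Nat.le_induction with
  | base => exact le_rfl
  | succ k _ ih => exact (ih (by omega)).trans (ht.2.2.2 k (by omega)).le

lemma IsPartition.mem_Icc {c d : ℝ} {n : ℕ} {t : ℕ → ℝ} (ht : IsPartition c d n t)
    {k : ℕ} (hk : k ≤ n) : t k ∈ Set.Icc c d := by
  have h0 := ht.apply_le_apply (Nat.zero_le k) hk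
  have h1 := ht.apply_le_apply hk le_rfl
  rw [ht.2.1] at h0
  rw [ht.2.2.1] at h1
  exact ⟨h0, h1⟩

lemma IsPartition.lt {c d : ℝ} {n : ℕ} {t : ℕ → ℝ} (ht : IsPartition c d n t) : c < d := by
  have h := ht.2.2.2 0 ht.1
  have h1 := (ht.mem_Icc (k := 1) ht.1).2
  rw [ht.2.1] at h
  exact h.trans_le h1

lemma wienerVar_le_ofReal_iff {p f : ℝ → ℝ} {c d M : ℝ} (hM : 0 ≤ M) :
    wienerVar p f c d ≤ ENNReal.ofReal M ↔ ∀ n t, IsPartition c d n t →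
      ∑ k ∈ Finset.range n, |f (t (k + 1)) - f (t k)| ^ pbar p (t k) (t (k + 1)) ≤ M := by
  simp only [wienerVar, iSup_le_iff, ENNReal.ofReal_le_ofReal_iff hM]

lemma wienerVar_eq_zero_of_le {p f : ℝ → ℝ} {c d : ℝ} (h : d ≤ c) : wienerVar p f c d = 0 := by
  simp only [wienerVar, ENNReal.iSup_eq_zero]
  intro n t ht
  exact absurd ht.lt h.not_gt

/-- The variation is superadditive when an interval is appended on the right. -/
lemma wienerVar_add_le {p f : ℝ → ℝ} {c x z : ℝ} (hcx : c < x) (hxz : x < z) :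
    wienerVar p f c x + ENNReal.ofReal (|f z - f x| ^ pbar p x z) ≤ wienerVar p f c z := by
  have key : ∀ n t, IsPartition c x n t →
      ENNReal.ofReal (∑ k ∈ Finset.range n,
        |f (t (k + 1)) - f (t k)| ^ pbar p (t k) (t (k + 1))) +
      ENNReal.ofReal (|f z - f x| ^ pbar p x z) ≤ wienerVar p f c z := by
    intro n t ht
    rw [← ENNReal.ofReal_add (Finset.sum_nonneg fun _ _ => by positivity) (by positivity)]
    let s : ℕ → ℝ := fun k => if k ≤ n then t k else z
    have hs : ∀ k ≤ n, s k = t k := fun k hk => if_pos hk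
    have hsz : s (n + 1) = z := if_neg (by omega)
    have hpart : IsPartition c z (n + 1) s := by
      refine ⟨by omega, by rw [hs 0 (by omega), ht.2.1], hsz, fun k hk => ?_⟩
      rcases Nat.lt_succ_iff_lt_or_eq.1 hk with h | rfl
      · rw [hs k h.le, hs (k + 1) h]; exact ht.2.2.2 k h
      · rw [hs k le_rfl, hsz, ht.2.2.1]; exact hxz
    have hsum : ∑ k ∈ Finset.range (n + 1),
          |f (s (k + 1)) - f (s k)| ^ pbar p (s k) (s (k + 1)) =
        (∑ k ∈ Finset.range n, |f (t (k + 1)) - f (t k)| ^ pbar p (t k) (t (k + 1))) +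
          |f z - f x| ^ pbar p x z := by
      rw [Finset.sum_range_succ, hsz, hs n le_rfl, ht.2.2.1]
      congr 1
      refine Finset.sum_congr rfl fun k hk => ?_
      have hk := Finset.mem_range.1 hk
      rw [hs k hk.le, hs (k + 1) hk]
    rw [← hsum]
    exact le_iSup_of_le (n + 1) (le_iSup_of_le s (le_iSup_of_le hpart le_rfl))
  have htriv : IsPartition c x 1 (fun k => if k = 0 then c else x) :=
    ⟨one_pos, by simp, by simp, fun k hk => by
      obtain rfl : k = 0 := by omega
      simpa using hcx⟩
  have hr : ENNReal.ofReal (|f z - f x| ^ pbar p x z) ≤ wienerVar p f c z :=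
    le_add_self.trans (key _ _ htriv)
  refine (add_le_add_left (iSup_le fun n => iSup_le fun t => iSup_le fun ht =>
    ENNReal.le_sub_of_add_le_right ENNReal.ofReal_ne_top (key n t ht)) _).trans_eq
    (tsub_add_cancel_of_le hr)

lemma wienerVar_mono_right {p f : ℝ → ℝ} {c : ℝ} : Monotone (wienerVar p f c) := by
  intro x z hxz
  rcases hxz.eq_or_lt with rfl | hxz
  · exact le_rfl
  rcases le_or_gt x c with h | h
  · rw [wienerVar_eq_zero_of_le h]; exact zero_le
  · exact le_self_add.trans (wienerVar_add_le h hxz)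

/-- If `f` vanishes at `a` and has finite variation with exponents at least `1`, then `f ∈ WBV`. -/
lemma memWBV_of_wienerVar_le {p f : ℝ → ℝ} {a b M : ℝ} (hM : 0 < M) (hfa : f a = 0)
    (hpbar : ∀ u v, a ≤ u → u < v → v ≤ b → 1 ≤ pbar p u v)
    (hf : wienerVar p f a b ≤ ENNReal.ofReal M) : MemWBV p f a b := by
  refine ⟨hfa, ?_⟩
  set l : ℝ := max 1 M
  have hl1 : 1 ≤ l := le_max_left _ _
  have hl0 : 0 < l := by linarith
  have hle : wienerVar p (fun x => f x / l) a b ≤ 1 := by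
    rw [← ENNReal.ofReal_one, wienerVar_le_ofReal_iff zero_le_one]
    intro n t ht
    have hsum := (wienerVar_le_ofReal_iff hM.le).1 hf n t ht
    calc _ ≤ ∑ k ∈ Finset.range n,
          |f (t (k + 1)) - f (t k)| ^ pbar p (t k) (t (k + 1)) / l := by
          refine Finset.sum_le_sum fun k hk => ?_
          have hk := Finset.mem_range.1 hk
          have hq := hpbar (t k) (t (k + 1)) (ht.mem_Icc hk.le).1 (ht.2.2.2 k hk) (ht.mem_Icc hk).2
          rw [← sub_div, abs_div, abs_of_pos hl0, Real.div_rpow (abs_nonneg _) hl0.le]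
          gcongr
          exact Real.self_le_rpow_of_one_le hl1 hq
      _ ≤ 1 := by
          rw [← Finset.sum_div, div_le_one hl0]
          exact hsum.trans (le_max_right _ _)
  exact (iInf_le_of_le l (iInf_le_of_le hl0 (iInf_le_of_le hle le_rfl))).trans_lt
    ENNReal.ofReal_lt_top

/-- A bound on the variation passes to pointwise limits. -/
lemma wienerVar_le_of_tendsto {ι : Type*} {L : Filter ι} [L.NeBot] {p f : ℝ → ℝ}
    {F : ι → ℝ → ℝ} {a b M : ℝ} (hM : 0 ≤ M)
    (hpbar : ∀ u v, a ≤ u → u < v → v ≤ b → 0 ≤ pbar p u v)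
    (hF : ∀ i, wienerVar p (F i) a b ≤ ENNReal.ofReal M)
    (hlim : ∀ x ∈ Set.Icc a b, Tendsto (fun i => F i x) L (nhds (f x))) :
    wienerVar p f a b ≤ ENNReal.ofReal M := by
  rw [wienerVar_le_ofReal_iff hM]
  intro n t ht
  refine le_of_tendsto (x := L) (tendsto_finsetSum (f := fun k i =>
    |F i (t (k + 1)) - F i (t k)| ^ pbar p (t k) (t (k + 1))) _ fun k hk => ?_)
    (Eventually.of_forall fun i => (wienerVar_le_ofReal_iff hM).1 (hF i) n t ht)
  have hk := Finset.mem_range.1 hk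
  exact (((hlim _ (ht.mem_Icc hk)).sub (hlim _ (ht.mem_Icc hk.le))).abs).rpow_const
    (Or.inr (hpbar _ _ (ht.mem_Icc hk.le).1 (ht.2.2.2 k hk) (ht.mem_Icc hk).2))

/-- The increments of `f` are controlled by those of its variation function. -/
lemma abs_sub_lt_of_wienerVar {p f : ℝ → ℝ} {a y x z P δ : ℝ} (hay : a < y) (hyx : y < x)
    (hxz : x ≤ z) (hq : 1 ≤ pbar p y x) (hqP : pbar p y x ≤ P) (hδ : 0 < δ) (hδ1 : δ ≤ 1)
    (hfin : wienerVar p f a z ≠ ⊤)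
    (h : (wienerVar p f a z).toReal - (wienerVar p f a y).toReal < δ ^ P) :
    |f x - f y| < δ := by
  have h1 : wienerVar p f a y + ENNReal.ofReal (|f x - f y| ^ pbar p y x) ≤ wienerVar p f a z :=
    (wienerVar_add_le hay hyx).trans (wienerVar_mono_right hxz)
  have hy : wienerVar p f a y ≠ ⊤ :=
    ne_top_of_le_ne_top hfin (wienerVar_mono_right (hyx.le.trans hxz))
  have h2 := ENNReal.toReal_mono hfin h1
  rw [ENNReal.toReal_add hy ENNReal.ofReal_ne_top, ENNReal.toReal_ofReal (by positivity)] at h2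
  by_contra! hcon
  have h3 : δ ^ P ≤ δ ^ pbar p y x := Real.rpow_le_rpow_of_exponent_ge hδ hδ1 hqP
  have h4 : δ ^ pbar p y x ≤ |f x - f y| ^ pbar p y x :=
    Real.rpow_le_rpow hδ.le hcon (by linarith)
  linarith

/-- A bounded sequence of reals converges along any ultrafilter. -/
lemma exists_tendsto_ultrafilter {ι : Type*} (U : Ultrafilter ι) {u : ι → ℝ} {K : ℝ}
    (hu : ∀ n, |u n| ≤ K) : ∃ l, Tendsto u U (nhds l) := by
  obtain ⟨l, -, hl⟩ := (isCompact_Icc (a := -K) (b := K)).ultrafilter_le_nhds (U.map u)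
    (le_principal_iff.2 (Ultrafilter.mem_map.2 (Filter.univ_mem' fun n => abs_le.1 (hu n))))
  exact ⟨l, hl⟩

/-- Helly-type selection principle in `WBV_{p(·)}[a,b]` for essentially
bounded exponents. -/
theorem wbv_helly_selection (a b : ℝ) (hab : a < b) (p : ℝ → ℝ)
    (hp1 : ∀ x ∈ Set.Icc a b, 1 ≤ p x)
    (hpint : MeasureTheory.IntegrableOn p (Set.Icc a b))
    (hesssup : ∃ M : ℝ, ∀ᵐ x ∂(volume.restrict (Set.Icc a b)), p x ≤ M)
    (F : ℕ → ℝ → ℝ) (hF : ∀ n, MemWBV p (F n) a b)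
    (K M : ℝ) (hK : 0 < K) (hM : 0 < M)
    (hbd : ∀ n, ∀ x ∈ Set.Icc a b, |F n x| ≤ K)
    (hvar : ∀ n, wienerVar p (F n) a b ≤ ENNReal.ofReal M) :
    ∃ (φ : ℕ → ℕ) (f : ℝ → ℝ), StrictMono φ ∧ MemWBV p f a b ∧
      wienerVar p f a b ≤ ENNReal.ofReal M ∧
      ∀ x ∈ Set.Icc a b,
        Filter.Tendsto (fun k => F (φ k) x) Filter.atTop (nhds (f x)) := by
  obtain ⟨P₀, hP₀⟩ := hesssup
  set P : ℝ := max 1 P₀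
  have hpbar : ∀ u v, a ≤ u → u < v → v ≤ b → pbar p u v ∈ Set.Icc 1 P :=
    fun u v hau huv hvb => pbar_mem_Icc hp1 hpint (le_max_left _ _)
      (hP₀.mono fun x hx => hx.trans (le_max_right _ _)) hau huv hvb
  let W : ℕ → ℝ → ℝ := fun n x => (wienerVar p (F n) a (min x b)).toReal
  have hWfin : ∀ n z, z ≤ b → wienerVar p (F n) a z ≠ ⊤ := fun n z hz =>
    ne_top_of_le_ne_top ENNReal.ofReal_ne_top ((wienerVar_mono_right hz).trans (hvar n))
  have hWmono : ∀ n, Monotone (W n) := fun n x z hxz =>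
    ENNReal.toReal_mono (hWfin n _ (min_le_right _ _))
      (wienerVar_mono_right (min_le_min_right b hxz))
  have hWbd : ∀ n x, |W n x| ≤ M := fun n x => by
    rw [abs_of_nonneg ENNReal.toReal_nonneg]
    exact ENNReal.toReal_le_of_le_ofReal hM.le
      ((wienerVar_mono_right (min_le_right _ _)).trans (hvar n))
  let U : Ultrafilter ℕ := hyperfilter ℕ
  have hU : (U : Filter ℕ) ≤ atTop := Nat.hyperfilter_le_atTop
  choose v hv using fun x => exists_tendsto_ultrafilter U fun n => hWbd n x
  have hflim : ∀ x, ∃ l, x ∈ Set.Icc a b → Tendsto (fun n => F n x) U (nhds l) := fun x => by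
    by_cases hx : x ∈ Set.Icc a b
    · exact (exists_tendsto_ultrafilter U fun n => hbd n x hx).imp fun _ h _ => h
    · exact ⟨0, fun h => absurd h hx⟩
  choose f hf using hflim
  have hvmono : Monotone v := fun x z hxz =>
    le_of_tendsto_of_tendsto' (hv x) (hv z) fun n => hWmono n hxz
  set C : Set ℝ := ({x | ¬ContinuousAt v x} ∪ (Set.range ((↑) : ℚ → ℝ) ∪ {a, b})) ∩ Set.Icc a b
  have hC : C.Countable := Set.Countable.mono Set.inter_subset_left
    (hvmono.countable_not_continuousAt.union
      ((Set.countable_range _).union (Set.toFinite {a, b}).countable))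
  have : Countable C := hC.to_subtype
  obtain ⟨φ, hφ, hlim⟩ : ∃ φ : ℕ → ℕ, StrictMono φ ∧ Tendsto
      ((fun n (x : C) => (W n x, F n x)) ∘ φ) atTop (nhds fun x : C => (v x, f x)) := by
    refine MapClusterPt.tendsto_subseq (Tendsto.mapClusterPt (F := U) ?_ |>.mono hU)
    exact tendsto_pi_nhds.2 fun x => (hv x).prodMk_nhds (hf x x.2.2)
  rw [tendsto_pi_nhds] at hlim
  have hWC : ∀ x ∈ C, Tendsto (fun k => W (φ k) x) atTop (nhds (v x)) := fun x hx =>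
    (hlim ⟨x, hx⟩).fst_nhds
  have hFC : ∀ x ∈ C, Tendsto (fun k => F (φ k) x) atTop (nhds (f x)) := fun x hx =>
    (hlim ⟨x, hx⟩).snd_nhds
  have hconv : ∀ x ∈ Set.Icc a b, Tendsto (fun k => F (φ k) x) atTop (nhds (f x)) := by
    intro x hx
    by_cases hxC : x ∈ C
    · exact hFC x hxC
    simp only [C, Set.mem_inter_iff, hx, and_true, Set.mem_union, not_or, Set.mem_ofPred_eq,
      not_not, Set.mem_insert_iff, Set.mem_singleton_iff] at hxC
    obtain ⟨hcont, -, hxa, hxb⟩ := hxC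
    have hax : a < x := lt_of_le_of_ne hx.1 (Ne.symm hxa)
    have hxb : x < b := lt_of_le_of_ne hx.2 hxb
    rw [Metric.tendsto_atTop']
    intro ε hε
    set δ : ℝ := min 1 (ε / 3)
    have hδ : 0 < δ := by positivity
    have hδ1 : δ ≤ 1 := min_le_left _ _
    have hδε : δ ≤ ε / 3 := min_le_right _ _
    have hη : 0 < δ ^ P := by positivity
    obtain ⟨r, hr, hball⟩ := Metric.continuousAt_iff.1 hcont (δ ^ P / 2) (half_pos hη)
    obtain ⟨y, hy1, hyx⟩ := exists_rat_btwn (max_lt hax (sub_lt_self x hr))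
    obtain ⟨z, hxz, hz1⟩ := exists_rat_btwn (lt_min hxb (lt_add_of_pos_right x hr))
    obtain ⟨hay, hyr⟩ := max_lt_iff.1 hy1
    obtain ⟨hzb, hzr⟩ := lt_min_iff.1 hz1
    have hyC : (y : ℝ) ∈ C := ⟨Or.inr (Or.inl ⟨y, rfl⟩), hay.le, by linarith⟩
    have hzC : (z : ℝ) ∈ C := ⟨Or.inr (Or.inl ⟨z, rfl⟩), by linarith, hzb.le⟩
    have hvzy : v z - v y < δ ^ P := by
      have h1 := hball (x := (y : ℝ)) (by rw [Real.dist_eq, abs_lt]; constructor <;> linarith)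
      have h2 := hball (x := (z : ℝ)) (by rw [Real.dist_eq, abs_lt]; constructor <;> linarith)
      rw [Real.dist_eq, abs_lt] at h1 h2
      linarith
    have hinc : ∀ n, W n z - W n y < δ ^ P → |F n x - F n y| < δ := fun n hn => by
      have hq := hpbar y x hay.le hyx hx.2
      simp only [W, min_eq_left hzb.le, min_eq_left (hyx.le.trans hx.2)] at hn
      exact abs_sub_lt_of_wienerVar hay hyx hxz.le hq.1 hq.2 hδ hδ1 (hWfin n z hzb.le) hn
    have hfxy : |f x - f y| ≤ δ := by
      refine le_of_tendsto ((hf x hx).sub (hf y hyC.2)).abs ?_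
      filter_upwards [((hv z).sub (hv y)).eventually_lt_const hvzy] with n hn
      exact (hinc n hn).le
    have hev : ∀ᶠ k in atTop, dist (F (φ k) x) (f x) < ε := by
      filter_upwards [((hWC z hzC).sub (hWC y hyC)).eventually_lt_const hvzy,
        Metric.tendsto_nhds.1 (hFC y hyC) δ hδ] with k hk1 hk2
      have h1 := abs_lt.1 (hinc (φ k) hk1)
      rw [Real.dist_eq, abs_lt] at hk2 ⊢
      have h3 := abs_le.1 hfxy
      constructor <;> linarith
    obtain ⟨N, hN⟩ := eventually_atTop.1 hev
    exact ⟨N, fun n hn => hN n hn.le⟩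
  have ha : a ∈ Set.Icc a b := Set.left_mem_Icc.2 hab.le
  have hfa : f a = 0 := by
    refine tendsto_nhds_unique (hf a ha) ?_
    simp only [(hF _).1]
    exact tendsto_const_nhds
  have hfvar : wienerVar p f a b ≤ ENNReal.ofReal M :=
    wienerVar_le_of_tendsto hM.le
      (fun u w h1 h2 h3 => zero_le_one.trans (hpbar u w h1 h2 h3).1) (fun k => hvar (φ k)) hconv
  exact ⟨φ, f, hφ, memWBV_of_wienerVar_le hM hfa (fun u w h1 h2 h3 => (hpbar u w h1 h2 h3).1) hfvar,
    hfvar, hconv⟩
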